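/- Let r₁,…,rₙ ∈ ℂ (n ≥ 1) be distinct, let m₁,…,mₙ be positive integers with d := m₁+⋯+mₙ ≥ 2, and set Q = ∑_{i=1}^n mᵢ∏_{j≠i}(X−rⱼ) and A = X·Q − ∏_{j=1}^n(X−rⱼ) in ℂ[X]. Then A has degree n with leading coefficient d − 1, Q has degree n − 1 with leading coefficient d, and A and Q are coprime. Consequently the reduced Newton map A/Q of ∏(X−rᵢ)^{mᵢ} is a rational map of degree exactly n, the number of distinct roots. -/

import Mathlib

open Finset Polynomial

theorem natDegree_prod_erase_X_sub_C {n : ℕ} (r : Fin n → ℂ) (i : Fin n) :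
    (∏ j ∈ univ.erase i, (X - C (r j))).natDegree = n - 1 := by
  rw [natDegree_finsetProd_X_sub_C_eq_card, card_erase_of_mem (mem_univ i), card_fin]

theorem coeff_prod_erase_X_sub_C {n : ℕ} (r : Fin n → ℂ) (i : Fin n) :
    (∏ j ∈ univ.erase i, (X - C (r j))).coeff (n - 1) = 1 := by
  rw [← natDegree_prod_erase_X_sub_C r i]
  exact monic_prod_X_sub_C r _

theorem eval_sum_mul_prod_erase {n : ℕ} (r c : Fin n → ℂ) (k : Fin n) :
    (∑ i, C (c i) * ∏ j ∈ univ.erase i, (X - C (r j))).eval (r k) =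
      c k * ∏ j ∈ univ.erase k, (r k - r j) := by
  rw [eval_finsetSum, sum_eq_single k]
  · simp [eval_prod]
  · intro i _ hik
    rw [eval_mul, eval_prod, prod_eq_zero (mem_erase.2 ⟨hik.symm, mem_univ k⟩) (by simp), mul_zero]
  · simp

/-- For distinct `r₁, …, rₙ` (`n ≥ 1`) and positive integers `mᵢ` with
`d = ∑ mᵢ ≥ 2`, setting `Q = ∑ i mᵢ ∏_{j≠i} (X - rⱼ)` and
`A = X*Q - ∏ j (X - rⱼ)`: `A` has degree `n` with leading coefficient `d - 1`,
`Q` has degree `n - 1` with leading coefficient `d`, and `A`, `Q` are coprime.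
Hence the reduced Newton map `A/Q` has degree exactly `n`. -/
theorem reducedNewton_degree
    (n : ℕ) (hn : 1 ≤ n) (r : Fin n → ℂ) (hr : Function.Injective r)
    (m : Fin n → ℕ) (hm : ∀ i, 0 < m i)
    (d : ℕ) (hd : d = ∑ i : Fin n, m i) (hd2 : 2 ≤ d)
    (Q A : Polynomial ℂ)
    (hQ : Q = ∑ i : Fin n, C ((m i : ℂ)) * ∏ j ∈ univ.erase i, (X - C (r j)))
    (hA : A = X * Q - ∏ j : Fin n, (X - C (r j))) :
    A.natDegree = n ∧ A.leadingCoeff = (d : ℂ) - 1 ∧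
    Q.natDegree = n - 1 ∧ Q.leadingCoeff = (d : ℂ) ∧
    IsCoprime A Q := by
  have hd0 : (d : ℂ) ≠ 0 := by
    exact_mod_cast (by omega : d ≠ 0)
  have hd1 : (d : ℂ) - 1 ≠ 0 := by
    rw [sub_ne_zero]
    exact_mod_cast (by omega : d ≠ 1)
  have hQle : Q.natDegree ≤ n - 1 := by
    rw [hQ]
    refine natDegree_sum_le_of_forall_le _ _ fun i _ => ?_
    exact (natDegree_C_mul_le _ _).trans (natDegree_prod_erase_X_sub_C r i).le
  have hQc : Q.coeff (n - 1) = d := by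
    simp [hQ, hd, finsetSum_coeff, coeff_prod_erase_X_sub_C]
  have hQd : Q.natDegree = n - 1 :=
    natDegree_eq_of_le_of_coeff_ne_zero hQle (by rwa [hQc])
  have hPd : (∏ j : Fin n, (X - C (r j))).natDegree = n := by
    rw [natDegree_finsetProd_X_sub_C_eq_card, card_fin]
  have hPc : (∏ j : Fin n, (X - C (r j))).coeff n = 1 := by
    have h : (∏ j : Fin n, (X - C (r j))).leadingCoeff = 1 := monic_prod_X_sub_C r univ
    rwa [leadingCoeff, hPd] at h
  have hAle : A.natDegree ≤ n := by
    rw [hA]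
    refine (natDegree_sub_le _ _).trans (max_le (natDegree_mul_le.trans ?_) hPd.le)
    rw [natDegree_X]
    omega
  have hAc : A.coeff n = (d : ℂ) - 1 := by
    have h : (X * Q).coeff n = (d : ℂ) := by
      rw [← hQc, ← coeff_X_mul Q, Nat.sub_add_cancel hn]
    rw [hA, coeff_sub, h, hPc]
  have hAd : A.natDegree = n :=
    natDegree_eq_of_le_of_coeff_ne_zero hAle (by rwa [hAc])
  have hPQ : IsCoprime (∏ j : Fin n, (X - C (r j))) Q := by
    refine IsCoprime.prod_left fun k _ => ?_
    refine (irreducible_X_sub_C (r k)).coprime_iff_not_dvd.2 ?_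
    rw [dvd_iff_isRoot, IsRoot.def, hQ, eval_sum_mul_prod_erase r (fun i => (m i : ℂ))]
    refine mul_ne_zero (Nat.cast_ne_zero.2 (hm k).ne') (prod_ne_zero_iff.2 fun j hj => ?_)
    exact sub_ne_zero.2 (hr.ne (ne_of_mem_erase hj).symm)
  refine ⟨hAd, by rw [leadingCoeff, hAd, hAc], hQd, by rw [leadingCoeff, hQd, hQc], ?_⟩
  rw [hA, sub_eq_neg_add]
  exact (IsCoprime.add_mul_right_left_iff).2 hPQ.neg_left
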